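/- arXiv:1310.5406 — 11 statements merged into one kernel-verified Lean document; each statement's English description precedes it below -/
import Mathlib

section
/- Let G : ℤ →₀ ℤ be a pleasantly alternating cycle supported in the interval [r, s] with G(r) = G(s) = 1, and let N = s - r. Then for every n ∈ ℤ all values of the cycle G_n lie in {-1, 0, 1}; moreover all values of G_n lie in {0, 1} when n ≥ N, and all values of G_n lie in {-1, 0} when n ≤ -N. -/
/-- The shift of a cycle: `(shiftCyc j G) i = G (i + j)`, i.e. `σ^j(G)`. -/
def shiftCyc (j : ℤ) (G : ℤ →₀ ℤ) : ℤ →₀ ℤ :=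
  Finsupp.equivMapDomain (Equiv.addRight (-j)) G

/-- The cycles `G_n`: `G_0 = 0`; `G_n = Σ_{j=0}^{n-1} σ^{-j}(G)` for `n ≥ 1`; and
`G_{-n} = -Σ_{j=1}^{n} σ^{j}(G)` for `n ≥ 1`. -/
noncomputable def cyc (G : ℤ →₀ ℤ) (n : ℤ) : ℤ →₀ ℤ :=
  if 0 ≤ n then ∑ j ∈ Finset.range n.toNat, shiftCyc (-(j : ℤ)) G
  else -(∑ j ∈ Finset.Icc 1 (-n).toNat, shiftCyc (j : ℤ) G)

/-- `G` is pleasantly alternating with respect to the interval `[r, s]`: it is supported in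
`[r, s]`, `G r = G s = 1`, all values lie in `{-1, 0, 1}`, and the nonzero values, read in
increasing order of indices, alternate strictly between `1` and `-1`. -/
def PleasantlyAlternatingOn (G : ℤ →₀ ℤ) (r s : ℤ) : Prop :=
  r ≤ s ∧ G r = 1 ∧ G s = 1 ∧
  (∀ i, G i ≠ 0 → r ≤ i ∧ i ≤ s) ∧
  (∀ i, G i = -1 ∨ G i = 0 ∨ G i = 1) ∧
  (∀ i j, i < j → G i ≠ 0 → G j ≠ 0 → (∀ t, i < t → t < j → G t = 0) → G j = -G i)

theorem shiftCyc_apply (j : ℤ) (G : ℤ →₀ ℤ) (i : ℤ) : shiftCyc j G i = G (i + j) := by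
  simp [shiftCyc, Finsupp.equivMapDomain_apply, Equiv.addRight]

/-- The cycle `G_n` is a difference of two translates of any antidifference of `G`. -/
theorem cyc_apply_eq_sub {G : ℤ →₀ ℤ} {P : ℤ → ℤ} (hP : ∀ i, P i = P (i - 1) + G i) (n i : ℤ) :
    cyc G n i = P i - P (i - n) := by
  have sum_neg (m : ℕ) :
      ∑ j ∈ Finset.range m, G (i + -(j : ℤ)) = P i - P (i - m) := by
    induction m with
    | zero => simp
    | succ m ih =>
      have := hP (i - m)
      rw [Finset.sum_range_succ, ih, ← sub_eq_add_neg]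
      push_cast
      rw [show i - ((m : ℤ) + 1) = i - m - 1 by ring]
      linarith
  have sum_pos (m : ℕ) :
      ∑ j ∈ Finset.Icc 1 m, G (i + (j : ℤ)) = P (i + m) - P i := by
    induction m with
    | zero => simp
    | succ m ih =>
      have := hP (i + (m + 1))
      rw [show i + ((m : ℤ) + 1) - 1 = i + m by ring] at this
      rw [Finset.sum_Icc_succ_top (by omega), ih]
      push_cast
      linarith
  unfold cyc
  split_ifs with hn
  · simp only [Finsupp.finsetSum_apply, shiftCyc_apply]
    rw [sum_neg, Int.toNat_of_nonneg hn]
  · simp only [Finsupp.neg_apply, Finsupp.finsetSum_apply, shiftCyc_apply]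
    rw [sum_pos, Int.toNat_of_nonneg (by omega), ← sub_eq_add_neg]
    ring

/-- The partial sums of a pleasantly alternating cycle lie in `{0, 1}`, vanish to the left of
the interval and equal `1` from its right endpoint on. -/
theorem PleasantlyAlternatingOn.exists_antidifference {G : ℤ →₀ ℤ} {r s : ℤ}
    (h : PleasantlyAlternatingOn G r s) :
    ∃ P : ℤ → ℤ, (∀ i, P i = P (i - 1) + G i) ∧ (∀ i, P i = 0 ∨ P i = 1) ∧
      (∀ i, i < r → P i = 0) ∧ (∀ i, s ≤ i → P i = 1) := by
  obtain ⟨hrs, hr, hs, hsupp, hval, halt⟩ := h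
  let P : ℤ → ℤ := fun i => ∑ t ∈ Finset.Icc r i, G t
  have hlt (i : ℤ) (hi : i < r) : P i = 0 := by simp [P, hi]
  have hstep (i : ℤ) : P i = P (i - 1) + G i := by
    by_cases hi : i < r
    · have hGi : G i = 0 := by
        by_contra hne
        have := hsupp i hne
        omega
      rw [hlt i hi, hlt (i - 1) (by omega), hGi, add_zero]
    · have hIcc : Finset.Icc r i = insert i (Finset.Icc r (i - 1)) := by
        ext t
        simp only [Finset.mem_Icc, Finset.mem_insert]
        omega
      simp only [P]
      rw [hIcc, Finset.sum_insert (by simp), add_comm]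
  have hlast (i : ℤ) (hi : r ≤ i) :
      ∃ k ≤ i, G k ≠ 0 ∧ G k = 2 * P i - 1 ∧ ∀ t, k < t → t ≤ i → G t = 0 := by
    induction i, hi using Int.leInduction with
    | base =>
      refine ⟨r, le_rfl, by omega, ?_, fun t _ _ => by omega⟩
      have := hstep r
      rw [hlt (r - 1) (by omega)] at this
      omega
    | succ i hi ih =>
      obtain ⟨k, hki, hk, hkP, hzero⟩ := ih
      have hnext := hstep (i + 1)
      rw [add_sub_cancel_right] at hnext
      by_cases hG : G (i + 1) = 0
      · refine ⟨k, by omega, hk, by omega, fun t hkt hti => ?_⟩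
        rcases hti.eq_or_lt with rfl | hti
        · exact hG
        · exact hzero t hkt (by omega)
      · have := halt k (i + 1) (by omega) hk hG fun t hkt hti => hzero t hkt (by omega)
        exact ⟨i + 1, le_rfl, hG, by omega, fun t _ _ => by omega⟩
  refine ⟨P, hstep, fun i => ?_, hlt, fun i hi => ?_⟩
  · by_cases hi : i < r
    · exact Or.inl (hlt i hi)
    · obtain ⟨k, -, hk, hkP, -⟩ := hlast i (by omega)
      have := hval k
      omega
  · obtain ⟨k, -, hk, hkP, hzero⟩ := hlast i (by omega)
    have hks : k = s := by
      refine le_antisymm (hsupp k hk).2 ?_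
      by_contra hsk
      have := hzero s (by omega) hi
      omega
    rw [hks, hs] at hkP
    omega

theorem cyc_values_of_pleasantlyAlternating (G : ℤ →₀ ℤ) (r s : ℤ)
    (h : PleasantlyAlternatingOn G r s) (N : ℤ) (hN : N = s - r) :
    (∀ n i : ℤ, cyc G n i = -1 ∨ cyc G n i = 0 ∨ cyc G n i = 1) ∧
    (∀ n i : ℤ, N ≤ n → cyc G n i = 0 ∨ cyc G n i = 1) ∧
    (∀ n i : ℤ, n ≤ -N → cyc G n i = -1 ∨ cyc G n i = 0) := by
  obtain ⟨P, hstep, hval, hlt, hge⟩ := h.exists_antidifference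
  simp only [cyc_apply_eq_sub hstep]
  refine ⟨fun n i => ?_, fun n i hn => ?_, fun n i hn => ?_⟩ <;>
    have h₁ := hval i <;> have h₂ := hval (i - n)
  · omega
  · by_cases hi : s ≤ i
    · have := hge i hi
      omega
    · have := hlt (i - n) (by omega)
      omega
  · by_cases hi : s ≤ i - n
    · have := hge (i - n) hi
      omega
    · have := hlt i (by omega)
      omega
end

section
/- Let G : ℤ →₀ ℤ be a pleasantly alternating cycle supported in the interval [r, s] with G(r) = G(s) = 1, and let N = s - r. Then for every n ≥ N one has min(G_n, -G_{-n}) = 0 and min(G_n, σ^n(G_n)) = 0, where min is taken pointwise. -/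
theorem cyc_natCast_apply {G : ℤ →₀ ℤ} {P : ℤ → ℤ} (hP : ∀ i, P (i + 1) = P i + G (i + 1))
    (n : ℕ) (i : ℤ) : cyc G n i = P i - P (i - n) := by
  have key : ∀ m : ℕ,
      (∑ j ∈ Finset.range m, shiftCyc (-(j : ℤ)) G) i = P i - P (i - m) := by
    intro m
    induction m with
    | zero => simp
    | succ m ih =>
      have h := hP (i - (m + 1))
      rw [show i - ((m : ℤ) + 1) + 1 = i - m by ring] at h
      rw [Finset.sum_range_succ, Finsupp.add_apply, ih, shiftCyc_apply, ← sub_eq_add_neg]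
      push_cast
      linarith
  simpa [cyc] using key n

theorem neg_cyc_neg_natCast_apply {G : ℤ →₀ ℤ} {P : ℤ → ℤ}
    (hP : ∀ i, P (i + 1) = P i + G (i + 1)) (n : ℕ) (i : ℤ) :
    -(cyc G (-n) i) = P (i + n) - P i := by
  have key : ∀ m : ℕ,
      (∑ j ∈ Finset.Icc 1 m, shiftCyc (j : ℤ) G) i = P (i + m) - P i := by
    intro m
    induction m with
    | zero => simp
    | succ m ih =>
      have h := hP (i + m)
      rw [Finset.sum_Icc_succ_top (by omega), Finsupp.add_apply, ih, shiftCyc_apply]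
      push_cast
      rw [← add_assoc]
      linarith
  rcases Nat.eq_zero_or_pos n with rfl | hn
  · simp [cyc]
  · have h : ¬ (0 : ℤ) ≤ -(n : ℤ) := by omega
    rw [cyc, if_neg h, Finsupp.neg_apply, neg_neg, neg_neg, Int.toNat_natCast, key n]

/-- The partial sums of an alternating cycle are determined by its last nonzero value. -/
theorem PleasantlyAlternatingOn.exists_last_ne_zero {G : ℤ →₀ ℤ} {r s : ℤ}
    (h : PleasantlyAlternatingOn G r s) {i : ℤ} (hi : r ≤ i) :
    ∃ k ≤ i, G k ≠ 0 ∧ (∀ t, k < t → t ≤ i → G t = 0) ∧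
      2 * ∑ t ∈ Finset.Icc r i, G t = 1 + G k := by
  obtain ⟨-, hr, -, -, hval, halt⟩ := h
  induction i, hi using Int.leInduction with
  | base => exact ⟨r, le_rfl, by omega, fun t _ _ => by omega, by simp [hr]⟩
  | succ i hi ih =>
    obtain ⟨k, hk, hk0, hzero, hsum⟩ := ih
    have hstep : ∑ t ∈ Finset.Icc r (i + 1), G t = (∑ t ∈ Finset.Icc r i, G t) + G (i + 1) := by
      rw [← Finset.insert_Icc_right_eq_Icc_add_one (by omega),
        Finset.sum_insert (by simp), add_comm]
    rw [hstep]
    by_cases h0 : G (i + 1) = 0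
    · refine ⟨k, by omega, hk0, fun t h1 h2 => ?_, by omega⟩
      rcases h2.lt_or_eq with h2 | rfl
      · exact hzero t h1 (by omega)
      · exact h0
    · have := halt k (i + 1) (by omega) hk0 h0 fun t h1 h2 => hzero t h1 (by omega)
      exact ⟨i + 1, le_rfl, h0, fun t _ _ => by omega, by omega⟩

theorem PleasantlyAlternatingOn.exists_primitive {G : ℤ →₀ ℤ} {r s : ℤ}
    (h : PleasantlyAlternatingOn G r s) :
    ∃ P : ℤ → ℤ, (∀ i, P (i + 1) = P i + G (i + 1)) ∧ (∀ i, P i = 0 ∨ P i = 1) ∧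
      (∀ i < r, P i = 0) ∧ ∀ i, s ≤ i → P i = 1 := by
  have hlt : ∀ i < r, ∑ t ∈ Finset.Icc r i, G t = 0 := fun i hi => by
    rw [Finset.Icc_eq_empty (by omega), Finset.sum_empty]
  refine ⟨fun i => ∑ t ∈ Finset.Icc r i, G t, fun i => ?_, fun i => ?_, hlt, fun i hi => ?_⟩
  · rcases le_or_gt r (i + 1) with hi | hi
    · dsimp only
      rw [← Finset.insert_Icc_right_eq_Icc_add_one hi,
        Finset.sum_insert (by simp), add_comm]
    · have h0 : G (i + 1) = 0 := by
        by_contra h0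
        have := (h.2.2.2.1 _ h0).1
        omega
      dsimp only
      rw [hlt _ hi, hlt i (by omega), h0, add_zero]
  · rcases le_or_gt r i with hi | hi
    · obtain ⟨k, -, hk0, -, hsum⟩ := h.exists_last_ne_zero hi
      have := h.2.2.2.2.1 k
      dsimp only
      omega
    · exact Or.inl (hlt i hi)
  · obtain ⟨k, -, hk0, hzero, hsum⟩ := h.exists_last_ne_zero (h.1.trans hi)
    obtain ⟨-, -, hs, hsupp, -, -⟩ := h
    have hks : k = s := by
      refine le_antisymm (hsupp k hk0).2 (not_lt.mp fun hlt => ?_)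
      have := hzero s hlt hi
      omega
    subst hks
    dsimp only
    omega

/-- For `n ≥ N = s - r`, one has `min(G_n, -G_{-n}) = 0` and `min(G_n, σ^n(G_n)) = 0`
pointwise. -/
theorem cyc_min_eq_zero (G : ℤ →₀ ℤ) (r s : ℤ)
    (h : PleasantlyAlternatingOn G r s) (N : ℤ) (hN : N = s - r) :
    ∀ n : ℤ, N ≤ n →
      (∀ i : ℤ, min (cyc G n i) (-(cyc G (-n) i)) = 0) ∧
      (∀ i : ℤ, min (cyc G n i) (shiftCyc n (cyc G n) i) = 0) := by
  intro n hn
  obtain ⟨P, hP, h01, hlow, hhigh⟩ := h.exists_primitive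
  have hrs := h.1
  lift n to ℕ using by omega
  have key : ∀ i : ℤ, min (P i - P (i - n)) (P (i + n) - P i) = 0 := by
    intro i
    have h1 := h01 i
    have h2 := h01 (i - n)
    have h3 := h01 (i + n)
    have h4 := hlow i
    have h5 := hhigh i
    have h6 := hlow (i - n)
    have h7 := hhigh (i + n)
    omega
  refine ⟨fun i => ?_, fun i => ?_⟩
  · rw [cyc_natCast_apply hP, neg_cyc_neg_natCast_apply hP, key]
  · rw [shiftCyc_apply, cyc_natCast_apply hP, cyc_natCast_apply hP, add_sub_cancel_right, key]
end

section
/- Let G : ℤ →₀ ℤ be a cycle supported in the interval [r, s] and let N = s - r. Suppose the cycle G_n is effective (pointwise nonnegative) for all sufficiently large n. Then either there exists an integer i with r ≤ i ≤ s-1 such that min(G_n, σ^n(G_n)) ≥ δ_i for all n ≥ N, or else min(G_n, σ^n(G_n)) = 0 for all n ≥ N. In the latter case G = c·P for some integer c ≥ 0 and some pleasantly alternating cycle P. -/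
/-- `G` is pleasantly alternating. -/
def PleasantlyAlternating (G : ℤ →₀ ℤ) : Prop :=
  ∃ r s : ℤ, PleasantlyAlternatingOn G r s

/-- The partial sum `∑_{k ≤ t} G k` of the values of a cycle. -/
def partialSum (G : ℤ →₀ ℤ) (t : ℤ) : ℤ :=
  ∑ k ∈ G.support, if k ≤ t then G k else 0

theorem partialSum_sub_partialSum_sub_one (G : ℤ →₀ ℤ) (t : ℤ) :
    partialSum G t - partialSum G (t - 1) = G t := by
  have h : ∀ k, ((if k ≤ t then G k else 0) - if k ≤ t - 1 then G k else 0) =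
      if k = t then G k else 0 := by
    intro k
    split_ifs <;> omega
  simp only [partialSum, ← Finset.sum_sub_distrib, h, Finset.sum_ite_eq']
  split_ifs with ht
  · rfl
  · exact (Finsupp.notMem_support_iff.mp ht).symm

theorem partialSum_eq_of_forall_eq_zero {G : ℤ →₀ ℤ} {i j : ℤ} (hij : i ≤ j)
    (h : ∀ t, i < t → t ≤ j → G t = 0) : partialSum G i = partialSum G j := by
  refine Finset.sum_congr rfl fun k _ => ?_
  split_ifs with h₁ h₂ h₂
  · rfl
  · omega
  · exact (h k (by omega) h₂).symm
  · rfl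

theorem partialSum_eq_zero {G : ℤ →₀ ℤ} {t : ℤ} (h : ∀ k ≤ t, G k = 0) :
    partialSum G t = 0 := by
  refine Finset.sum_eq_zero fun k _ => ?_
  split_ifs with hk
  · exact h k hk
  · rfl

theorem cyc_apply (G : ℤ →₀ ℤ) {n : ℤ} (hn : 0 ≤ n) (t : ℤ) :
    cyc G n t = partialSum G t - partialSum G (t - n) := by
  lift n to ℕ using hn
  simp only [cyc, Int.natCast_nonneg, if_true, Int.toNat_natCast, Finsupp.finsetSum_apply,
    shiftCyc_apply]
  induction n with
  | zero => simp
  | succ n ih =>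
    rw [Finset.sum_range_succ, ih, ← partialSum_sub_partialSum_sub_one G (t + -n)]
    push_cast
    rw [← sub_eq_add_neg, sub_sub]
    ring

theorem pleasantlyAlternating_single (i : ℤ) : PleasantlyAlternating (Finsupp.single i 1) := by
  refine ⟨i, i, le_rfl, by simp, by simp, fun k hk => ?_, fun k => ?_, fun k l hkl hk hl _ => ?_⟩
  · rw [Finsupp.single_apply_ne_zero] at hk
    omega
  · rw [Finsupp.single_apply]
    split_ifs <;> simp
  · rw [Finsupp.single_apply_ne_zero] at hk hl
    omega

/-- A cycle whose partial sums only take the values `0` and `c`, the latter eventually, is `c`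
times a pleasantly alternating cycle. -/
theorem exists_eq_smul_pleasantlyAlternating {G : ℤ →₀ ℤ} {s c : ℤ} (hc : 0 ≤ c)
    (hs : ∀ t, s ≤ t → partialSum G t = c)
    (h : ∀ t, partialSum G t = 0 ∨ partialSum G t = c) :
    ∃ P : ℤ →₀ ℤ, PleasantlyAlternating P ∧ G = c • P := by
  have hG := partialSum_sub_partialSum_sub_one G
  obtain rfl | hc := hc.eq_or_lt
  · refine ⟨_, pleasantlyAlternating_single 0, ?_⟩
    ext t
    have := hG t
    have := h t
    have := h (t - 1)
    simp only [zero_smul, Finsupp.zero_apply]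
    omega
  have hne : G.support.Nonempty := by
    rw [Finset.nonempty_iff_ne_empty]
    intro h₀
    have := hs s le_rfl
    simp only [partialSum, h₀, Finset.sum_empty] at this
    omega
  have hval : ∀ t, G t = -c ∨ G t = 0 ∨ G t = c := by
    intro t
    have := hG t
    have := h t
    have := h (t - 1)
    omega
  have hP : ∃ P : ℤ →₀ ℤ, G = c • P := by
    refine ⟨G.mapRange (· / c) (Int.zero_ediv c), ?_⟩
    ext t
    have : c ∣ G t := by
      rcases hval t with h | h | h <;> simp [h]
    simp [Int.mul_ediv_cancel' this]
  obtain ⟨P, hP⟩ := hP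
  have hPt : ∀ t, G t = c * P t := fun t => by simp [hP]
  have hne_zero : ∀ t, P t ≠ 0 ↔ G t ≠ 0 := fun t => by simp [hPt, hc.ne']
  have heq_one : ∀ t, G t = c → P t = 1 := fun t ht =>
    mul_left_cancel₀ hc.ne' (by rw [← hPt, ht, mul_one])
  have hmin : ∀ t, G t ≠ 0 → G.support.min' hne ≤ t := fun t ht =>
    Finset.min'_le _ _ (Finsupp.mem_support_iff.mpr ht)
  have hmax : ∀ t, G t ≠ 0 → t ≤ G.support.max' hne := fun t ht =>
    Finset.le_max' _ _ (Finsupp.mem_support_iff.mpr ht)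
  have hmin_ne := Finsupp.mem_support_iff.mp (Finset.min'_mem _ hne)
  have hmax_ne := Finsupp.mem_support_iff.mp (Finset.max'_mem _ hne)
  generalize G.support.min' hne = a at *
  generalize G.support.max' hne = b at *
  refine ⟨P, ⟨a, b, hmin b hmax_ne, heq_one a ?_, heq_one b ?_, fun i hi => ?_, fun i => ?_,
    fun i j hij hi hj hz => ?_⟩, hP⟩
  · have h₀ : partialSum G (a - 1) = 0 := partialSum_eq_zero fun k hk => by
      by_contra hk₀
      have := hmin k hk₀
      omega
    have := hG a
    have := h a
    omega
  · have h₁ : partialSum G b = partialSum G (max b s) :=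
      partialSum_eq_of_forall_eq_zero (le_max_left b s) fun k hk _ => by
        by_contra hk₀
        have := hmax k hk₀
        omega
    rw [hs _ (le_max_right b s)] at h₁
    have := hG b
    have := h (b - 1)
    omega
  · rw [hne_zero] at hi
    exact ⟨hmin i hi, hmax i hi⟩
  · rcases hval i with hi | hi | hi
    · exact Or.inl (mul_left_cancel₀ hc.ne' (by rw [← hPt, hi, mul_neg_one]))
    · exact Or.inr (Or.inl (mul_left_cancel₀ hc.ne' (by rw [← hPt, hi, mul_zero])))
    · exact Or.inr (Or.inr (heq_one i hi))
  · rw [hne_zero] at hi hj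
    have hz' : partialSum G i = partialSum G (j - 1) :=
      partialSum_eq_of_forall_eq_zero (by omega) fun t h₁ h₂ => by
        rw [hPt, hz t h₁ (by omega), mul_zero]
    refine mul_left_cancel₀ hc.ne' ?_
    rw [mul_neg, ← hPt, ← hPt]
    have := hG i
    have := hG j
    have := h i
    have := h (i - 1)
    have := h j
    omega

/-- If `G` is supported in `[r, s]`, `N = s - r`, and `G_n` is effective for all `n ≫ 0`,
then either there is `r ≤ i ≤ s - 1` with `δ_i ≤ min(G_n, σ^n(G_n))` for all `n ≥ N`,
or else `min(G_n, σ^n(G_n)) = 0` for all `n ≥ N`; in the latter case `G` is a nonnegative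
multiple of a pleasantly alternating cycle. -/
theorem cyc_min_dichotomy (G : ℤ →₀ ℤ) (r s : ℤ) (hrs : r ≤ s)
    (hsupp : ∀ i, G i ≠ 0 → r ≤ i ∧ i ≤ s) (N : ℤ) (hN : N = s - r)
    (heff : ∃ n₁ : ℤ, ∀ n : ℤ, n₁ ≤ n → ∀ i : ℤ, 0 ≤ cyc G n i) :
    (∃ i : ℤ, r ≤ i ∧ i ≤ s - 1 ∧ ∀ n : ℤ, N ≤ n → ∀ t : ℤ,
        (Finsupp.single i 1 : ℤ →₀ ℤ) t ≤ min (cyc G n t) (shiftCyc n (cyc G n) t)) ∨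
    ((∀ n : ℤ, N ≤ n → ∀ t : ℤ, min (cyc G n t) (shiftCyc n (cyc G n) t) = 0) ∧
      ∃ (c : ℤ) (P : ℤ →₀ ℤ), 0 ≤ c ∧ PleasantlyAlternating P ∧ G = c • P) := by
  have hlow : ∀ t, t < r → partialSum G t = 0 := fun t ht => partialSum_eq_zero fun k hk => by
    by_contra h₀
    have := hsupp k h₀
    omega
  obtain ⟨c, hc⟩ : ∃ c, partialSum G s = c := ⟨_, rfl⟩
  have hhigh : ∀ t, s ≤ t → partialSum G t = c := fun t ht => by
    rw [← hc, partialSum_eq_of_forall_eq_zero ht]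
    intro k hk _
    by_contra h₀
    have := hsupp k h₀
    omega
  have hbound : ∀ t, 0 ≤ partialSum G t ∧ partialSum G t ≤ c := by
    intro t
    obtain ⟨n₁, hn₁⟩ := heff
    obtain ⟨n, hn, hn₀, hr, hs⟩ : ∃ n, n₁ ≤ n ∧ 0 ≤ n ∧ t - n < r ∧ s ≤ t + n :=
      ⟨|n₁| + |t - r| + |s - t| + 1, by grind, by grind, by grind, by grind⟩
    have h₁ := hn₁ n hn t
    have h₂ := hn₁ n hn (t + n)
    rw [cyc_apply G hn₀] at h₁ h₂
    rw [hlow _ hr] at h₁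
    rw [hhigh _ hs, add_sub_cancel_right] at h₂
    omega
  have hcyc : ∀ n, N ≤ n → ∀ t, min (cyc G n t) (shiftCyc n (cyc G n) t) =
      min (partialSum G t) (c - partialSum G t) := by
    intro n hn t
    have hn₀ : 0 ≤ n := by omega
    rw [shiftCyc_apply, cyc_apply G hn₀, cyc_apply G hn₀, add_sub_cancel_right]
    have := hbound (t - n)
    have := hbound (t + n)
    have := hbound t
    rcases lt_or_ge t r with hr | hr
    · have := hlow t hr
      have := hlow (t - n) (by omega)
      omega
    rcases lt_or_ge t s with hs | hs
    · rw [hlow (t - n) (by omega), hhigh (t + n) (by omega), sub_zero]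
    · have := hhigh t hs
      have := hhigh (t + n) (by omega)
      omega
  by_cases h : ∃ i, 0 < partialSum G i ∧ partialSum G i < c
  · obtain ⟨i, hi₀, hic⟩ := h
    refine Or.inl ⟨i, ?_, ?_, fun n hn t => ?_⟩
    · by_contra! hr
      exact hi₀.ne' (hlow i hr)
    · by_contra! hs
      exact hic.ne (hhigh i (by omega))
    · rw [hcyc n hn, Finsupp.single_apply]
      have := hbound t
      split_ifs with hit
      · subst hit
        omega
      · omega
  · push Not at h
    have hval : ∀ t, partialSum G t = 0 ∨ partialSum G t = c := fun t => by
      have := h t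
      have := hbound t
      omega
    refine Or.inr ⟨fun n hn t => ?_, ?_⟩
    · rw [hcyc n hn]
      have := hval t
      have := hbound t
      omega
    · have hc₀ : 0 ≤ c := (hbound s).1.trans (hbound s).2
      exact ⟨c, (exists_eq_smul_pleasantlyAlternating hc₀ hhigh hval).imp fun P hP => ⟨hc₀, hP⟩⟩
end

section
/- Let R be a commutative noetherian domain with fraction field K, identified with its image in K, and let σ : R ≃+* R be a ring automorphism. Let H be a nonzero proper ideal of R such that σ^i(H) + σ^j(H) = R for all integers i ≠ j, where σ^i(H) denotes the image ideal of H under σ^i. For a finite subset S ⊆ ℤ write H[S] = ∏_{i ∈ S} σ^i(H). Then for any finite subsets B, C ⊆ ℤ one has { x ∈ K | x·H[B] ⊆ H[C] } ∩ R = H[C \ B]. -/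
/-- For an ideal `I` of `R`, automorphism `σ`, and a finite subset `S ⊆ ℤ`,
`I[S] = ∏_{i ∈ S} σ^i(I)` (empty product is `R`). -/
def idealProd {R : Type*} [CommRing R] (σ : R ≃+* R) (I : Ideal R) (S : Finset ℤ) : Ideal R :=
  ∏ i ∈ S, Ideal.map (σ ^ i) I

section

variable {R : Type*} [CommRing R] (σ : R ≃+* R) (I : Ideal R)

theorem idealProd_anti {S T : Finset ℤ} (h : S ⊆ T) : idealProd σ I T ≤ idealProd σ I S :=
  Ideal.le_of_dvd (Finset.prod_dvd_prod_of_subset _ _ _ h)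

theorem idealProd_sdiff_mul_le (B C : Finset ℤ) :
    idealProd σ I (C \ B) * idealProd σ I B ≤ idealProd σ I C := by
  have h : idealProd σ I (C \ B) * idealProd σ I (C ∩ B) = idealProd σ I C := by
    rw [mul_comm]
    exact Finset.prod_inter_mul_prod_sdiff C B _
  rw [← h]
  exact Ideal.mul_mono_right (idealProd_anti σ I Finset.inter_subset_right)

theorem isCoprime_idealProd
    (h : ∀ i j : ℤ, i ≠ j → Ideal.map (σ ^ i) I + Ideal.map (σ ^ j) I = ⊤)
    {S T : Finset ℤ} (hST : Disjoint S T) : IsCoprime (idealProd σ I S) (idealProd σ I T) :=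
  IsCoprime.prod_left fun i hi => IsCoprime.prod_right fun j hj =>
    Ideal.isCoprime_iff_sup_eq.mpr (h i j (Finset.disjoint_left.mp hST hi <| · ▸ hj))

theorem forall_mul_mem_idealProd_iff
    (h : ∀ i j : ℤ, i ≠ j → Ideal.map (σ ^ i) I + Ideal.map (σ ^ j) I = ⊤)
    (B C : Finset ℤ) (r : R) :
    (∀ b ∈ idealProd σ I B, r * b ∈ idealProd σ I C) ↔ r ∈ idealProd σ I (C \ B) := by
  refine ⟨fun hr => ?_, fun hr b hb =>
    idealProd_sdiff_mul_le σ I B C (Ideal.mul_mem_mul hr hb)⟩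
  obtain ⟨b, hb, c, hc, hbc⟩ := Ideal.isCoprime_iff_exists.mp
    (isCoprime_idealProd σ I h (Finset.disjoint_sdiff : Disjoint B (C \ B)))
  rw [← mul_one r, ← hbc, mul_add]
  exact add_mem (idealProd_anti σ I Finset.sdiff_subset (hr b hb)) (Ideal.mul_mem_left _ r hc)

end

/-- If `H` is a nonzero proper ideal of a commutative noetherian domain `R` whose
`σ`-translates are pairwise comaximal, then inside `K = Frac(R)` one has
`{ x ∈ K | x·H[B] ⊆ H[C] } ∩ R = H[C \ B]`. -/
theorem hom_of_translate_products (R : Type*) [CommRing R] [IsDomain R] [IsNoetherianRing R]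
    (σ : R ≃+* R) (H : Ideal R) (hH0 : H ≠ ⊥) (hHtop : H ≠ ⊤)
    (hlonely : ∀ i j : ℤ, i ≠ j → Ideal.map (σ ^ i) H + Ideal.map (σ ^ j) H = ⊤)
    (B C : Finset ℤ) :
    {x : FractionRing R | ∀ b ∈ idealProd σ H B,
        x * algebraMap R (FractionRing R) b ∈
          algebraMap R (FractionRing R) '' (idealProd σ H C : Set R)} ∩
      Set.range (algebraMap R (FractionRing R)) =
    algebraMap R (FractionRing R) '' (idealProd σ H (C \ B) : Set R) := by
  have hinj : Function.Injective (algebraMap R (FractionRing R)) :=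
    IsFractionRing.injective R (FractionRing R)
  have key (r : R) := forall_mul_mem_idealProd_iff σ H hlonely B C r
  ext x
  constructor
  · rintro ⟨hx, r, rfl⟩
    refine ⟨r, (key r).mp fun b hb => ?_, rfl⟩
    have hb' := hx b hb
    rwa [← map_mul, hinj.mem_set_image] at hb'
  · rintro ⟨r, hr, rfl⟩
    exact ⟨fun b hb => ⟨r * b, (key r).mpr hr b hb, map_mul _ r b⟩, r, rfl⟩
end

section
/- Let k be a field and B a ℤ-graded k-algebra with grading 𝒜 : ℤ → Submodule k B. Suppose that for some integer r ≥ 1 the algebra B is generated as a k-algebra by the union of the homogeneous components 𝒜_i for -r ≤ i ≤ r. Then for every n > r one has 𝒜_n = Σ_{i=1}^{r} 𝒜_i · 𝒜_{n-i}, where the product of submodules is taken inside B. In particular, the nonnegatively graded part B_{≥0} is generated as a k-algebra by the components 𝒜_i with 0 ≤ i ≤ r. -/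
section GradedGeneration

variable {k B : Type*} [CommRing k] [Ring B] [Algebra k B]
  (𝒜 : ℤ → Submodule k B) [GradedAlgebra 𝒜] {r : ℤ}

/-- A product of homogeneous elements of degrees in `[-r, r]`, multiplied on the left by an element
of nonpositive degree, can be split after a factor of degree in `[1, r]` as soon as its total degree
is positive. -/
theorem exists_degree_mul_mem_sum_of_mem_closure {w : B}
    (hw : w ∈ Submonoid.closure (⋃ i ∈ Finset.Icc (-r) r, (𝒜 i : Set B))) :
    ∃ e : ℤ, w ∈ 𝒜 e ∧ ∀ d ≤ 0, 0 < d + e → ∀ a ∈ 𝒜 d,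
      a * w ∈ ∑ i ∈ Finset.Icc 1 r, 𝒜 i * 𝒜 (d + e - i) := by
  induction hw using Submonoid.closure_induction_left with
  | one => exact ⟨0, SetLike.GradedOne.one_mem, fun d hd hpos => by omega⟩
  | mul_left x hx w _ ih =>
    obtain ⟨e, hwe, ih⟩ := ih
    simp only [Set.mem_iUnion, Finset.mem_Icc, SetLike.mem_coe] at hx
    obtain ⟨i, ⟨-, hir⟩, hxi⟩ := hx
    refine ⟨i + e, SetLike.mul_mem_graded hxi hwe, fun d hd hpos a ha => ?_⟩
    have hax : a * x ∈ 𝒜 (d + i) := SetLike.mul_mem_graded ha hxi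
    rw [← mul_assoc, ← add_assoc]
    rcases le_or_gt (d + i) 0 with h | h
    · exact ih (d + i) h (by omega) _ hax
    · have hle : 𝒜 (d + i) * 𝒜 (d + i + e - (d + i)) ≤
          ∑ j ∈ Finset.Icc 1 r, 𝒜 j * 𝒜 (d + i + e - j) :=
        Finset.single_le_sum (f := fun j => 𝒜 j * 𝒜 (d + i + e - j))
          (fun _ _ => zero_le) (Finset.mem_Icc.2 ⟨by omega, by omega⟩)
      exact hle (Submodule.mul_mem_mul hax (by rwa [add_sub_cancel_left]))

theorem sum_mul_le_graded (n : ℤ) (s : Finset ℤ) :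
    ∑ i ∈ s, 𝒜 i * 𝒜 (n - i) ≤ 𝒜 n := by
  refine Finset.sum_induction _ (· ≤ 𝒜 n) (fun _ _ => sup_le) bot_le fun i _ => ?_
  refine Submodule.mul_le.2 fun a ha b hb => ?_
  simpa using SetLike.mul_mem_graded ha hb

/-- Positive components of an algebra generated in degrees `[-r, r]`. -/
theorem graded_eq_sum_mul_of_pos
    (hgen : Algebra.adjoin k (⋃ i ∈ Finset.Icc (-r) r, (𝒜 i : Set B)) = ⊤)
    {n : ℤ} (hn : 0 < n) : 𝒜 n = ∑ i ∈ Finset.Icc 1 r, 𝒜 i * 𝒜 (n - i) := by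
  refine le_antisymm (fun b hb => ?_) (sum_mul_le_graded 𝒜 n _)
  have key : (⊤ : Submodule k B) ≤
      (∑ i ∈ Finset.Icc 1 r, 𝒜 i * 𝒜 (n - i)).comap (GradedAlgebra.proj 𝒜 n) := by
    rw [← Algebra.top_toSubmodule, ← hgen, Algebra.adjoin_eq_span, Submodule.span_le]
    intro w hw
    obtain ⟨e, hwe, h⟩ := exists_degree_mul_mem_sum_of_mem_closure 𝒜 hw
    rw [SetLike.mem_coe, Submodule.mem_comap, GradedAlgebra.proj_apply]
    by_cases hen : e = n
    · subst hen
      rw [DirectSum.decompose_of_mem_same 𝒜 hwe]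
      simpa using h 0 le_rfl (by omega) 1 SetLike.GradedOne.one_mem
    · rw [DirectSum.decompose_of_mem_ne 𝒜 hwe hen]
      exact zero_mem _
  have hproj := key (Submodule.mem_top (x := b))
  rwa [Submodule.mem_comap, GradedAlgebra.proj_apply,
    DirectSum.decompose_of_mem_same 𝒜 hb] at hproj

/-- The components of degree in `[0, r]` generate all nonnegative components. -/
theorem graded_le_adjoin_of_nonneg (hr : 0 ≤ r)
    (hgen : Algebra.adjoin k (⋃ i ∈ Finset.Icc (-r) r, (𝒜 i : Set B)) = ⊤) (n : ℕ) :
    𝒜 n ≤ Subalgebra.toSubmodule (Algebra.adjoin k (⋃ i ∈ Finset.Icc 0 r, (𝒜 i : Set B))) := by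
  induction n using Nat.strong_induction_on with
  | _ n ih =>
    have hsmall : ∀ i : ℤ, 0 ≤ i → i ≤ r → 𝒜 i ≤
        Subalgebra.toSubmodule (Algebra.adjoin k (⋃ i ∈ Finset.Icc 0 r, (𝒜 i : Set B))) :=
      fun i h0 hi b hb => Algebra.subset_adjoin
        (Set.mem_biUnion (Finset.mem_coe.2 (Finset.mem_Icc.2 ⟨h0, hi⟩)) hb)
    rcases le_or_gt (n : ℤ) r with h | h
    · exact hsmall n (by omega) h
    rw [graded_eq_sum_mul_of_pos 𝒜 hgen (by omega : (0 : ℤ) < n)]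
    refine Finset.sum_induction _ (· ≤ Subalgebra.toSubmodule _) (fun _ _ => sup_le) bot_le
      fun i hi => Submodule.mul_le.2 fun a ha b hb => ?_
    obtain ⟨hi1, hir⟩ := Finset.mem_Icc.1 hi
    obtain ⟨m, hm⟩ := Int.eq_ofNat_of_zero_le (by omega : 0 ≤ (n : ℤ) - i)
    exact Subalgebra.mul_mem _ (hsmall i (by omega) hir ha) (ih m (by omega) (hm ▸ hb))

end GradedGeneration

/-- If a ℤ-graded `k`-algebra `B` is generated as a `k`-algebra by its homogeneous
components `𝒜_i` for `-r ≤ i ≤ r` (with `r ≥ 1`), then `𝒜_n = Σ_{i=1}^{r} 𝒜_i · 𝒜_{n-i}`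
for all `n > r`; in particular the nonnegative part `B_{≥0}` is generated as a `k`-algebra
by the components `𝒜_i` with `0 ≤ i ≤ r`. -/
theorem graded_quasi_fg (k B : Type*) [Field k] [Ring B] [Algebra k B]
    (𝒜 : ℤ → Submodule k B) [GradedAlgebra 𝒜] (r : ℤ) (hr : 1 ≤ r)
    (hgen : Algebra.adjoin k (⋃ i ∈ Finset.Icc (-r) r, (𝒜 i : Set B)) = ⊤) :
    (∀ n : ℤ, r < n → 𝒜 n = ∑ i ∈ Finset.Icc 1 r, 𝒜 i * 𝒜 (n - i)) ∧
    Algebra.adjoin k (⋃ i ∈ Finset.Icc 0 r, (𝒜 i : Set B)) =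
      Algebra.adjoin k (⋃ i ∈ {i : ℤ | 0 ≤ i}, (𝒜 i : Set B)) := by
  refine ⟨fun n hn => graded_eq_sum_mul_of_pos 𝒜 hgen (by omega), le_antisymm ?_ ?_⟩
  · exact Algebra.adjoin_mono
      (Set.biUnion_subset_biUnion_left fun i hi => (Finset.mem_Icc.1 hi).1)
  · refine Algebra.adjoin_le (Set.iUnion₂_subset fun i hi => ?_)
    obtain ⟨n, rfl⟩ := Int.eq_ofNat_of_zero_le hi
    exact graded_le_adjoin_of_nonneg 𝒜 (by omega) hgen n
end

section
/- Let A be a ℤ-graded ring with grading 𝒜 : ℤ → AddSubgroup A such that 𝒜_n ≠ 0 for all n ∈ ℤ. Suppose A is a simple ring, i.e. A is nontrivial and its only two-sided ideals are 0 and A. Then for every n ≥ 1 the sum of additive subgroups Σ_{i ≥ n} (𝒜_i·𝒜_{-i} + 𝒜_{-i}·𝒜_i) equals 𝒜_0; in particular it contains 1. -/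
/-- For additive subgroups `M, N` of a ring, `M·N` is the additive subgroup generated by
all products `m·n` with `m ∈ M`, `n ∈ N`. -/
def addSubgroupMul {A : Type*} [Ring A] (M N : AddSubgroup A) : AddSubgroup A :=
  AddSubgroup.closure {x | ∃ m ∈ M, ∃ n ∈ N, x = m * n}

/-- A product `x * a * y` of homogeneous elements of total degree zero, with `a` of degree `n + n`,
factors as a product of homogeneous elements of opposite degrees of absolute value at least `n`. -/
theorem mul_mul_mem_iSup_addSubgroupMul {A : Type*} [Ring A] (𝒜 : ℤ → AddSubgroup A)
    [GradedRing 𝒜] {n p q : ℤ} {a x y : A} (ha : a ∈ 𝒜 (n + n)) (hx : x ∈ 𝒜 p) (hy : y ∈ 𝒜 q)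
    (hpq : p + (n + n) + q = 0) :
    x * a * y ∈ ⨆ i ∈ {i : ℤ | n ≤ i},
      addSubgroupMul (𝒜 i) (𝒜 (-i)) ⊔ addSubgroupMul (𝒜 (-i)) (𝒜 i) := by
  have hxa : x * a ∈ 𝒜 (p + (n + n)) := SetLike.mul_mem_graded hx ha
  have hay : a * y ∈ 𝒜 (n + n + q) := SetLike.mul_mem_graded ha hy
  by_cases hp : p ≤ -n
  · refine AddSubgroup.mem_iSup_of_mem (-p) (AddSubgroup.mem_iSup_of_mem
      (show n ≤ -p by lia) (AddSubgroup.mem_sup_right (AddSubgroup.subset_closure ?_)))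
    refine ⟨x, by rwa [neg_neg], a * y, ?_, mul_assoc x a y⟩
    rwa [show -p = n + n + q by lia]
  · refine AddSubgroup.mem_iSup_of_mem (p + (n + n)) (AddSubgroup.mem_iSup_of_mem
      (show n ≤ p + (n + n) by lia) (AddSubgroup.mem_sup_left (AddSubgroup.subset_closure ?_)))
    refine ⟨x * a, hxa, y, ?_, rfl⟩
    rwa [show -(p + (n + n)) = q by lia]

/-- The degree zero component of `x * a * y`, with `a` homogeneous of degree `n + n`, is a sum of
products of homogeneous elements of opposite degrees of absolute value at least `n`. -/
theorem proj_zero_mul_mul_mem_iSup_addSubgroupMul {A : Type*} [Ring A] (𝒜 : ℤ → AddSubgroup A)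
    [GradedRing 𝒜] {n : ℤ} {a : A} (ha : a ∈ 𝒜 (n + n)) (x y : A) :
    GradedRing.proj 𝒜 0 (x * a * y) ∈ ⨆ i ∈ {i : ℤ | n ≤ i},
      addSubgroupMul (𝒜 i) (𝒜 (-i)) ⊔ addSubgroupMul (𝒜 (-i)) (𝒜 i) := by
  induction x using DirectSum.Decomposition.inductionOn 𝒜 with
  | zero => simp [zero_mem]
  | add x x' hx hx' => rw [add_mul, add_mul, map_add]; exact add_mem hx hx'
  | @homogeneous p x =>
    induction y using DirectSum.Decomposition.inductionOn 𝒜 with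
    | zero => simp [zero_mem]
    | add y y' hy hy' => rw [mul_add, map_add]; exact add_mem hy hy'
    | @homogeneous q y =>
      have hmem : (x : A) * a * y ∈ 𝒜 (p + (n + n) + q) :=
        SetLike.mul_mem_graded (SetLike.mul_mem_graded x.2 ha) y.2
      rw [GradedRing.proj_apply]
      by_cases hpq : p + (n + n) + q = 0
      · rw [DirectSum.decompose_of_mem_same 𝒜 (hpq ▸ hmem)]
        exact mul_mul_mem_iSup_addSubgroupMul 𝒜 ha x.2 y.2 hpq
      · rw [DirectSum.decompose_of_mem_ne 𝒜 hmem hpq]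
        exact zero_mem _

/-- If `A` is a ℤ-graded simple ring whose homogeneous components are all nonzero, then
for every `n ≥ 1` the additive subgroup `Σ_{i ≥ n} (𝒜_i·𝒜_{-i} + 𝒜_{-i}·𝒜_i)` equals
`𝒜_0`. -/
theorem graded_simple_comaximal (A : Type*) [Ring A] (𝒜 : ℤ → AddSubgroup A)
    [GradedRing 𝒜] (hnz : ∀ n : ℤ, 𝒜 n ≠ ⊥) (hsimple : IsSimpleRing A) :
    ∀ n : ℤ, 1 ≤ n →
      (⨆ i ∈ {i : ℤ | n ≤ i},
        addSubgroupMul (𝒜 i) (𝒜 (-i)) ⊔ addSubgroupMul (𝒜 (-i)) (𝒜 i)) = 𝒜 0 := by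
  intro n _
  apply le_antisymm
  · refine iSup₂_le fun i _ => sup_le ?_ ?_ <;> refine (AddSubgroup.closure_le _).2 ?_ <;>
      rintro _ ⟨x, hx, y, hy, rfl⟩ <;> simpa using SetLike.mul_mem_graded hx hy
  · intro z hz
    obtain ⟨a, ha, ha0⟩ := (𝒜 (n + n)).bot_or_exists_ne_zero.resolve_left (hnz (n + n))
    have hspan : TwoSidedIdeal.span {a} = ⊤ :=
      (eq_bot_or_eq_top _).resolve_left fun h => ha0 <| by
        simpa [h] using TwoSidedIdeal.subset_span (Set.mem_singleton a)
    have hza : z ∈ TwoSidedIdeal.span {a} := hspan ▸ trivial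
    rw [TwoSidedIdeal.mem_span_iff_mem_addSubgroup_closure] at hza
    have hproj : GradedRing.proj 𝒜 0 z = z := by
      rw [GradedRing.proj_apply, DirectSum.decompose_of_mem_same 𝒜 hz]
    rw [← hproj, ← AddSubgroup.mem_comap]
    refine (AddSubgroup.closure_le _).2 ?_ hza
    rintro _ ⟨_, ⟨x, _, _, rfl, rfl⟩, y, _, rfl⟩
    exact proj_zero_mul_mul_mem_iSup_addSubgroupMul 𝒜 ha x y
end

section
/- Let k be a field, d ≥ 1, and p : Fin d → k^× units such that for every v : Fin d → ℤ, ∏_i (p i)^{v i} = 1 implies v = 0 (the p_i generate a free abelian subgroup of k^×). Let T = AddMonoidAlgebra k (Fin d → ℤ) be the Laurent polynomial ring in d variables, and let σ be a k-algebra automorphism of T satisfying σ(single v r) = (∏_i (p i)^{v i}) • single v r for all v : Fin d → ℤ and r ∈ k, where single v r denotes the monomial with exponent vector v and coefficient r. Then T is σ-simple: the only ideals I of T with σ(I) = I are the zero ideal and T. -/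
/-- A nonzero subspace stable under a diagonal endomorphism of `k[G]` whose eigenvalues on the
monomials are pairwise distinct contains a monomial. -/
theorem AddMonoidAlgebra.exists_single_mem_of_diagonal {k G : Type*} [Field k]
    {χ : G → k} (hχ : Function.Injective χ)
    (f : AddMonoidAlgebra k G →ₗ[k] AddMonoidAlgebra k G)
    (hf : ∀ v r, f (.single v r) = χ v • .single v r)
    (N : Submodule k (AddMonoidAlgebra k G)) (hN : ∀ x ∈ N, f x ∈ N)
    {x : AddMonoidAlgebra k G} (hx : x ∈ N) (hx0 : x ≠ 0) :
    ∃ v, AddMonoidAlgebra.single v 1 ∈ N := by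
  classical
  have hcoeff : ∀ (y : AddMonoidAlgebra k G) (u : G), (f y).coeff u = χ u * y.coeff u := by
    intro y u
    induction y using AddMonoidAlgebra.induction_linear with
    | zero => simp
    | add a b ha hb => simp [ha, hb, mul_add]
    | single v r =>
      rw [hf]
      by_cases h : v = u
      · subst h; simp
      · simp [h]
  induction h : x.coeff.support.card using Nat.strong_induction_on generalizing x with
  | _ n ih =>
    obtain ⟨v, hv⟩ : ∃ v, x.coeff v ≠ 0 := by
      by_contra! hzero
      exact hx0 (AddMonoidAlgebra.coeff_injective (Finsupp.ext hzero))
    by_cases hsingle : ∀ w, x.coeff w ≠ 0 → w = v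
    · refine ⟨v, ?_⟩
      have hxv : AddMonoidAlgebra.single v 1 = (x.coeff v)⁻¹ • x := by
        ext u
        by_cases hu : v = u
        · subst hu; simp [hv]
        · have : x.coeff u = 0 := by
            by_contra hne
            exact hu (hsingle u hne).symm
          simp [hu, this]
      rw [hxv]
      exact N.smul_mem _ hx
    · push Not at hsingle
      obtain ⟨w, hw, hwv⟩ := hsingle
      have hy : ∀ u, (f x - χ v • x).coeff u = (χ u - χ v) * x.coeff u := by
        intro u
        simp [hcoeff, sub_mul]
      refine ih _ ?_ (N.sub_mem (hN x hx) (N.smul_mem (χ v) hx)) ?_ rfl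
      · rw [← h]
        refine Finset.card_lt_card (Finset.ssubset_iff_of_subset ?_ |>.2 ⟨v, ?_, ?_⟩)
        · intro u hu
          rw [Finsupp.mem_support_iff, hy] at hu
          exact Finsupp.mem_support_iff.2 (right_ne_zero_of_mul hu)
        · exact Finsupp.mem_support_iff.2 hv
        · rw [Finsupp.notMem_support_iff, hy, sub_self, zero_mul]
      · intro hzero
        have hyw := hy w
        rw [hzero] at hyw
        exact mul_ne_zero (sub_ne_zero.2 (hχ.ne hwv)) hw hyw.symm

/-- Let `T = k[x_1^{±1}, …, x_d^{±1}]` be the Laurent polynomial ring (the group algebra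
of `ℤ^d` over `k`), and let `σ` be the `k`-algebra automorphism scaling the monomial of
exponent vector `v` by `∏_i p_i^{v_i}`, where the units `p_i` generate a free abelian
subgroup of `k^×`. Then `T` is `σ`-simple: the only ideals with `σ(I) = I` are `0` and
`T`. -/
theorem laurent_sigma_simple (k : Type*) [Field k] (d : ℕ) (hd : 1 ≤ d)
    (p : Fin d → kˣ)
    (hp : ∀ v : Fin d → ℤ, (∏ i, (p i) ^ (v i)) = 1 → v = 0)
    (σ : AddMonoidAlgebra k (Fin d → ℤ) ≃ₐ[k] AddMonoidAlgebra k (Fin d → ℤ))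
    (hσ : ∀ (v : Fin d → ℤ) (r : k),
      σ (AddMonoidAlgebra.single v r) =
        ((∏ i, (p i) ^ (v i) : kˣ) : k) • AddMonoidAlgebra.single v r) :
    ∀ I : Ideal (AddMonoidAlgebra k (Fin d → ℤ)), Ideal.map σ I = I → I = ⊥ ∨ I = ⊤ := by
  intro I hI
  refine or_iff_not_imp_left.2 fun hbot ↦ ?_
  obtain ⟨x, hx, hx0⟩ := Submodule.exists_mem_ne_zero_of_ne_bot hbot
  have hχ : Function.Injective fun v : Fin d → ℤ ↦ ((∏ i, (p i) ^ (v i) : kˣ) : k) := by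
    intro v w hvw
    have hvw' := Units.ext hvw
    refine sub_eq_zero.1 (hp (v - w) ?_)
    simp only [Pi.sub_apply, zpow_sub, Finset.prod_mul_distrib, Finset.prod_inv_distrib]
    rw [hvw', mul_inv_cancel]
  obtain ⟨v, hv⟩ := AddMonoidAlgebra.exists_single_mem_of_diagonal hχ
    σ.toLinearMap hσ (I.restrictScalars k)
    (fun y hy ↦ hI.le (Ideal.mem_map_of_mem σ hy)) hx hx0
  refine Ideal.eq_top_of_isUnit_mem I hv (IsUnit.of_mul_eq_one (.single (-v) 1) ?_)
  simp [AddMonoidAlgebra.single_mul_single, AddMonoidAlgebra.one_def]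
end

section
/- Let k be a field of characteristic 0, let m ≥ 0, and let p : Fin m → k^× be units such that for every v : Fin m → ℤ, ∏_i (p i)^{v i} = 1 implies v = 0. Let R₀ = AddMonoidAlgebra k (Fin m → ℤ) be the Laurent polynomial ring in m variables and T = Polynomial R₀, so T = k[x_1, x_2^{±1}, …, x_{m+1}^{±1}] with x_1 = X. Let σ be a k-algebra automorphism of T satisfying σ(X) = X + 1 and σ(C(single v r)) = C((∏_i (p i)^{v i}) • single v r) for all v : Fin m → ℤ and r ∈ k. Then T is σ-simple: the only ideals I of T with σ(I) = I are the zero ideal and T. -/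
open Polynomial in
/-- A ring endomorphism of `R[X]` acting on constants by `τ` and sending `X` to `X + r` is
`τ` on coefficients followed by the Taylor shift by `r`. -/
theorem Polynomial.eq_taylor_map {R : Type*} [CommRing R] (φ : R[X] →+* R[X]) (τ : R →+* R)
    (r : R) (hX : φ X = X + C r) (hC : ∀ a, φ (C a) = C (τ a)) (f : R[X]) :
    φ f = taylor r (f.map τ) := by
  have h : φ = (taylorAlgHom r : R[X] →+* R[X]).comp (mapRingHom τ) :=
    ringHom_ext (by simp [hC]) (by simp [hX])
  simpa using DFunLike.congr_fun h f

open Polynomial in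
theorem Polynomial.coeff_taylor_of_natDegree_le {R : Type*} [CommRing R] {f : R[X]} {n : ℕ}
    (hf : f.natDegree ≤ n) (r : R) : (taylor r f).coeff n = f.coeff n := by
  have h : (hasseDeriv n f).natDegree < 1 := by
    have := natDegree_hasseDeriv_le f n
    omega
  rw [taylor_coeff, eval_eq_sum_range' h]
  simp [hasseDeriv_coeff]

open Polynomial in
theorem Polynomial.coeff_taylor_of_natDegree_le_succ {R : Type*} [CommRing R] {f : R[X]} {n : ℕ}
    (hf : f.natDegree ≤ n + 1) (r : R) :
    (taylor r f).coeff n = f.coeff n + (n + 1) * f.coeff (n + 1) * r := by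
  have h : (hasseDeriv n f).natDegree < 2 := by
    have := natDegree_hasseDeriv_le f n
    omega
  rw [taylor_coeff, eval_eq_sum_range' h]
  simp [Finset.sum_range_succ, hasseDeriv_coeff, add_comm 1 n]

theorem AddMonoidAlgebra.isUnit_single {k G : Type*} [Field k] [AddCommGroup G] (v : G) {r : k}
    (hr : r ≠ 0) : IsUnit (single v r) :=
  IsUnit.of_mul_eq_one (single (-v) r⁻¹) (by
    rw [single_mul_single, add_neg_cancel, mul_inv_cancel₀ hr, one_def])

/-- Multiplicatively independent units give distinct values on distinct exponent vectors. -/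
theorem injective_prod_zpow {G ι : Type*} [CommGroup G] [Fintype ι] (p : ι → G)
    (hp : ∀ v : ι → ℤ, ∏ i, p i ^ v i = 1 → v = 0) :
    Function.Injective fun v : ι → ℤ => ∏ i, p i ^ v i := by
  intro v w h
  refine sub_eq_zero.1 (hp (v - w) ?_)
  simpa [zpow_sub, Finset.prod_mul_distrib, mul_inv_eq_one] using h

open Polynomial in
/-- Let `τ` be an endomorphism of the group algebra `k[G]` scaling the monomial of exponent `v`
by `χ v`, with `χ` injective. A nonzero ideal of `k[G][X]` stable under
`f ↦ taylor 1 (f.map τ)` is the whole ring. -/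
theorem Ideal.eq_top_of_taylor_map_mem {k G : Type*} [Field k] [CharZero k] [AddCommGroup G]
    (τ : AddMonoidAlgebra k G →+* AddMonoidAlgebra k G) (χ : G → k)
    (hχ : Function.Injective χ) (hτ : ∀ a v, (τ a).coeff v = χ v * a.coeff v)
    (I : Ideal (AddMonoidAlgebra k G)[X]) (hI : ∀ f ∈ I, taylor 1 (f.map τ) ∈ I)
    (hbot : I ≠ ⊥) : I = ⊤ := by
  classical
  obtain ⟨f₀, hf₀, hf₀'⟩ := Submodule.exists_mem_ne_zero_of_ne_bot hbot
  obtain ⟨f, ⟨hfI, hf0⟩, hmin⟩ := WellFounded.has_min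
    (InvImage.wf (fun f : (AddMonoidAlgebra k G)[X] =>
      toLex (f.natDegree, f.leadingCoeff.coeff.support.card)) wellFounded_lt)
    {f | f ∈ I ∧ f ≠ 0} ⟨f₀, hf₀, hf₀'⟩
  set d := f.natDegree with hd
  set a := f.leadingCoeff with ha
  have ha0 : a.coeff ≠ 0 := fun h =>
    hf0 (leadingCoeff_eq_zero.1 (AddMonoidAlgebra.coeff_injective h))
  obtain ⟨v, hv⟩ := Finsupp.ne_iff.1 ha0
  rw [Finsupp.zero_apply] at hv
  have hmap : (f.map τ).natDegree ≤ d := natDegree_map_le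
  have hcoeff : (taylor 1 (f.map τ)).coeff d = τ a := by
    rw [coeff_taylor_of_natDegree_le hmap, coeff_map]; rfl
  have heig : taylor 1 (f.map τ) = χ v • f := by
    rw [← sub_eq_zero]
    by_contra hg0
    set g := taylor 1 (f.map τ) - χ v • f with hg
    have hgI : g ∈ I := I.sub_mem (hI f hfI) (Submodule.smul_of_tower_mem I (χ v) hfI)
    have hgd : g.natDegree ≤ d := (natDegree_sub_le _ _).trans
      (max_le (by rwa [natDegree_taylor]) (natDegree_smul_le _ _))
    refine hmin g ⟨hgI, hg0⟩ (Prod.Lex.toLex_lt_toLex.2 ?_)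
    rcases hgd.lt_or_eq with h | h
    · exact Or.inl h
    refine Or.inr ⟨h, Finset.card_lt_card ?_⟩
    have hlead (w : G) : g.leadingCoeff.coeff w = (χ w - χ v) * a.coeff w := by
      rw [← coeff_natDegree, h, hg, coeff_sub, hcoeff, coeff_smul]
      simp [hτ, sub_mul, ha, hd]
    refine Finset.ssubset_iff_subset_ne.2 ⟨fun w hw => ?_, fun h => ?_⟩
    · rw [Finsupp.mem_support_iff, hlead] at hw
      exact Finsupp.mem_support_iff.2 (right_ne_zero_of_mul hw)
    · have := h ▸ Finsupp.mem_support_iff.2 hv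
      simp [hlead] at this
  have hsingle : a = AddMonoidAlgebra.single v (a.coeff v) := by
    ext w
    rw [AddMonoidAlgebra.coeff_single, Finsupp.single_apply]
    split_ifs with h
    · rw [h]
    · by_contra hw
      have h1 : (τ a).coeff w = χ v * a.coeff w := by
        rw [← hcoeff, heig, coeff_smul]; rfl
      rw [hτ] at h1
      exact h (hχ (mul_right_cancel₀ hw h1)).symm
  have haunit : IsUnit a := hsingle ▸ AddMonoidAlgebra.isUnit_single v hv
  have hχv : χ v ≠ 0 := fun h => (haunit.map τ).ne_zero (by rw [← hcoeff, heig, h]; simp)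
  have hd0 : d = 0 := by
    by_contra hne
    obtain ⟨n, hn⟩ := Nat.exists_eq_succ_of_ne_zero hne
    have h := congrArg (fun g => (g.coeff n).coeff v) heig
    have hlead : f.coeff (n + 1) = a := by rw [ha, ← coeff_natDegree, ← hd, hn]
    simp only [coeff_taylor_of_natDegree_le_succ (hmap.trans hn.le), coeff_map, hlead, mul_one,
      coeff_smul, AddMonoidAlgebra.coeff_add, Finsupp.add_apply, hτ,
      AddMonoidAlgebra.coeff_smul_apply, smul_eq_mul, add_eq_left] at h
    rw [← Nat.cast_succ, ← nsmul_eq_mul, AddMonoidAlgebra.coeff_smul_apply, hτ, nsmul_eq_mul] at h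
    exact mul_ne_zero (Nat.cast_ne_zero.2 n.succ_ne_zero) (mul_ne_zero hχv hv) h
  refine Ideal.eq_top_of_isUnit_mem I hfI ?_
  rw [eq_C_of_natDegree_eq_zero hd0, ← hd0]
  exact haunit.map C

/-- Let `R₀ = k[x_2^{±1}, …, x_{m+1}^{±1}]` be the Laurent polynomial ring in `m`
variables and `T = R₀[X]`, so `T = k[x_1, x_2^{±1}, …, x_{m+1}^{±1}]` with `x_1 = X`.
If `char k = 0`, `σ` is a `k`-algebra automorphism of `T` with `σ(X) = X + 1` which
scales the Laurent monomial of exponent vector `v` by `∏_i p_i^{v_i}`, where the `p_i`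
generate a free abelian subgroup of `k^×`, then `T` is `σ`-simple. -/
theorem mixed_laurent_sigma_simple (k : Type*) [Field k] [CharZero k] (m : ℕ)
    (p : Fin m → kˣ)
    (hp : ∀ v : Fin m → ℤ, (∏ i, (p i) ^ (v i)) = 1 → v = 0)
    (σ : Polynomial (AddMonoidAlgebra k (Fin m → ℤ)) ≃ₐ[k]
      Polynomial (AddMonoidAlgebra k (Fin m → ℤ)))
    (hσX : σ Polynomial.X = Polynomial.X + 1)
    (hσC : ∀ (v : Fin m → ℤ) (r : k),
      σ (Polynomial.C (AddMonoidAlgebra.single v r)) =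
        Polynomial.C (((∏ i, (p i) ^ (v i) : kˣ) : k) • AddMonoidAlgebra.single v r)) :
    ∀ I : Ideal (Polynomial (AddMonoidAlgebra k (Fin m → ℤ))),
      Ideal.map σ I = I → I = ⊥ ∨ I = ⊤ := by
  intro I hI
  refine or_iff_not_imp_left.2 fun hbot => ?_
  set χ : (Fin m → ℤ) → k := fun v => ((∏ i, (p i) ^ (v i) : kˣ) : k)
  set τ : AddMonoidAlgebra k (Fin m → ℤ) →+* AddMonoidAlgebra k (Fin m → ℤ) :=
    (Polynomial.constantCoeff.comp (σ : _ →+* _)).comp Polynomial.C with hτ_def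
  have hspec (a : AddMonoidAlgebra k (Fin m → ℤ)) :
      σ (Polynomial.C a) = Polynomial.C (τ a) ∧ ∀ v, (τ a).coeff v = χ v * a.coeff v := by
    induction a using AddMonoidAlgebra.induction_linear with
    | zero => simp
    | add a b ha hb =>
      refine ⟨by simp [ha.1, hb.1], fun v => ?_⟩
      simp [ha.2, hb.2, mul_add]
    | single w r =>
      have h : τ (AddMonoidAlgebra.single w r) = χ w • AddMonoidAlgebra.single w r := by
        simp [hτ_def, hσC, χ]
      refine ⟨by rw [h, hσC], fun v => ?_⟩
      rw [h, AddMonoidAlgebra.coeff_smul_apply, smul_eq_mul,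
        AddMonoidAlgebra.coeff_single, Finsupp.single_apply]
      split_ifs with hwv
      · rw [hwv]
      · simp
  refine Ideal.eq_top_of_taylor_map_mem τ χ
    (Units.val_injective.comp (injective_prod_zpow p hp)) (fun a => (hspec a).2) I
    (fun f hf => ?_) hbot
  rw [← Polynomial.eq_taylor_map (σ : _ →+* _) τ 1 (by simpa using hσX) fun a => (hspec a).1]
  have := Ideal.mem_map_of_mem σ hf
  rwa [hI] at this
end

section
/- Let k be a field, d ≥ 1, and p : Fin d → k^× with ∏_i (p i)^{v i} = 1 implying v = 0 for every v : Fin d → ℤ. Let T = AddMonoidAlgebra k (Fin d → ℤ) and let σ be a k-algebra automorphism of T with σ(single v r) = (∏_i (p i)^{v i}) • single v r for all v, r. Let C be a k-subalgebra of T such that σ(C) = C, C is σ-simple (the only ideals I of the ring C with σ(I) = I are 0 and C), and C has the same field of fractions as T in the sense that for every t ∈ T there exist a, b ∈ C with b ≠ 0 and t·b = a. Then C = T. -/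
/-- A subspace stable under an endomorphism contains, together with a finite sum of
eigenvectors with distinct eigenvalues, each of the summands. -/
theorem Submodule.mem_of_sum_eigenvectors_mem {K V ι : Type*} [Field K] [AddCommGroup V]
    [Module K V] (f : V →ₗ[K] V) (W : Submodule K V) (hW : ∀ x ∈ W, f x ∈ W)
    (μ : ι → K) (hμ : Function.Injective μ) (s : Finset ι) (v : ι → V)
    (hv : ∀ i, f (v i) = μ i • v i) (hs : ∑ i ∈ s, v i ∈ W) : ∀ i ∈ s, v i ∈ W := by
  classical
  induction s using Finset.induction_on generalizing v with
  | empty => simp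
  | insert a s ha ih =>
    have hmem : ∑ i ∈ s, (μ i - μ a) • v i ∈ W := by
      have h := W.sub_mem (hW _ hs) (W.smul_mem (μ a) hs)
      rw [map_sum, Finset.smul_sum, ← Finset.sum_sub_distrib, Finset.sum_insert ha] at h
      simpa [hv, sub_smul] using h
    have hrest : ∀ i ∈ s, v i ∈ W := fun i hi ↦ by
      have h := ih (fun i ↦ (μ i - μ a) • v i)
        (fun i ↦ by simp only [map_smul, hv]; exact smul_comm _ _ _) hmem i hi
      refine (W.smul_mem_iff (sub_ne_zero.2 fun h ↦ ha ?_)).1 h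
      exact hμ h ▸ hi
    intro i hi
    rcases Finset.mem_insert.1 hi with rfl | hi
    · rw [Finset.sum_insert ha] at hs
      exact (W.add_mem_iff_left (W.sum_mem hrest)).1 hs
    · exact hrest i hi

/-- Let `T = k[x_1^{±1}, …, x_d^{±1}]` with `σ` the `k`-algebra automorphism scaling the
monomial of exponent vector `v` by `∏_i p_i^{v_i}`, the `p_i` generating a free abelian
subgroup of `k^×`. If `C` is a `σ`-stable `k`-subalgebra of `T` which is `σ`-simple
(the only subsets of `C` that are ideals of the ring `C` and are stable under `σ` are
`{0}` and `C`) and has the same fraction field as `T` (every `t ∈ T` is a quotient of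
elements of `C`), then `C = T`. -/
theorem sigma_simple_subalgebra_eq (k : Type*) [Field k] (d : ℕ) (hd : 1 ≤ d)
    (p : Fin d → kˣ)
    (hp : ∀ v : Fin d → ℤ, (∏ i, (p i) ^ (v i)) = 1 → v = 0)
    (σ : AddMonoidAlgebra k (Fin d → ℤ) ≃ₐ[k] AddMonoidAlgebra k (Fin d → ℤ))
    (hσ : ∀ (v : Fin d → ℤ) (r : k),
      σ (AddMonoidAlgebra.single v r) =
        ((∏ i, (p i) ^ (v i) : kˣ) : k) • AddMonoidAlgebra.single v r)
    (C : Subalgebra k (AddMonoidAlgebra k (Fin d → ℤ)))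
    (hCstable : ∀ x, x ∈ C ↔ σ x ∈ C)
    (hCsimple : ∀ S : Set (AddMonoidAlgebra k (Fin d → ℤ)),
      S ⊆ (C : Set (AddMonoidAlgebra k (Fin d → ℤ))) →
      (0 : AddMonoidAlgebra k (Fin d → ℤ)) ∈ S →
      (∀ a b, a ∈ S → b ∈ S → a + b ∈ S) →
      (∀ a, a ∈ S → -a ∈ S) →
      (∀ c a, c ∈ C → a ∈ S → c * a ∈ S) →
      σ '' S = S → S = {0} ∨ S = (C : Set (AddMonoidAlgebra k (Fin d → ℤ))))
    (hfrac : ∀ t : AddMonoidAlgebra k (Fin d → ℤ),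
      ∃ a ∈ C, ∃ b ∈ C, b ≠ 0 ∧ t * b = a) :
    C = ⊤ := by
  set χ : (Fin d → ℤ) → k := fun v ↦ ((∏ i, (p i) ^ (v i) : kˣ) : k) with hχ
  have hinj : Function.Injective χ := fun v w h ↦ by
    have h' : (∏ i, (p i) ^ (v i)) = ∏ i, (p i) ^ (w i) := Units.ext h
    refine sub_eq_zero.1 (hp _ ?_)
    simp [zpow_sub, Finset.prod_mul_distrib, h']
  have hmono : ∀ f ∈ C, ∀ v ∈ f.coeff.support, AddMonoidAlgebra.single v (1 : k) ∈ C := by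
    intro f hf v hv
    have h := Submodule.mem_of_sum_eigenvectors_mem σ.toLinearMap (Subalgebra.toSubmodule C)
      (fun x hx ↦ (hCstable x).1 hx) χ hinj f.coeff.support
      (fun v ↦ AddMonoidAlgebra.single v (f.coeff v)) (fun v ↦ hσ v _)
      (by
        have : ∑ v ∈ f.coeff.support, AddMonoidAlgebra.single v (f.coeff v) = f :=
          AddMonoidAlgebra.sum_coeff_single f
        rw [this]; exact hf) v hv
    have h' := C.smul_mem h (f.coeff v)⁻¹
    rwa [AddMonoidAlgebra.smul_single, smul_eq_mul, inv_mul_cancel₀ (by simpa using hv)] at h'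
  have hinv : ∀ v, AddMonoidAlgebra.single v (1 : k) ∈ C →
      AddMonoidAlgebra.single (-v) (1 : k) ∈ C := by
    intro v hv
    have hχ0 : χ v ≠ 0 := Units.ne_zero _
    have hS := hCsimple ((fun c ↦ AddMonoidAlgebra.single v (1 : k) * c) '' C)
      (by rintro _ ⟨c, hc, rfl⟩; exact C.mul_mem hv hc)
      ⟨0, C.zero_mem, mul_zero _⟩
      (by
        rintro _ _ ⟨a, ha, rfl⟩ ⟨b, hb, rfl⟩
        exact ⟨a + b, C.add_mem ha hb, mul_add _ _ _⟩)
      (by rintro _ ⟨a, ha, rfl⟩; exact ⟨-a, C.neg_mem ha, mul_neg _ _⟩)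
      (by
        rintro c _ hc ⟨a, ha, rfl⟩
        exact ⟨c * a, C.mul_mem hc ha, mul_left_comm _ _ _⟩)
      (by
        ext x
        constructor
        · rintro ⟨_, ⟨c, hc, rfl⟩, rfl⟩
          refine ⟨χ v • σ c, C.smul_mem ((hCstable c).1 hc) _, ?_⟩
          simp only [map_mul, hσ, hχ, smul_mul_assoc, mul_smul_comm]
        · rintro ⟨c, hc, rfl⟩
          refine ⟨_, ⟨(χ v)⁻¹ • σ.symm c, C.smul_mem ((hCstable _).2 (by simpa using hc)) _,
            rfl⟩, ?_⟩
          simp only [map_mul, hσ, map_smul, AlgEquiv.apply_symm_apply, smul_mul_assoc,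
            mul_smul_comm, smul_smul]
          rw [show ((∏ i, p i ^ v i : kˣ) : k) = χ v from rfl, inv_mul_cancel₀ hχ0, one_smul])
    rcases hS with h | h
    · have h1 : AddMonoidAlgebra.single v (1 : k) ∈
          (fun c ↦ AddMonoidAlgebra.single v (1 : k) * c) '' C := ⟨1, C.one_mem, mul_one _⟩
      rw [h, Set.mem_singleton_iff, AddMonoidAlgebra.single_eq_zero] at h1
      exact absurd h1 one_ne_zero
    · have h1 : (1 : AddMonoidAlgebra k (Fin d → ℤ)) ∈
          (fun c ↦ AddMonoidAlgebra.single v (1 : k) * c) '' C := by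
        rw [h]; exact C.one_mem
      obtain ⟨c, hc, hvc⟩ := h1
      have : AddMonoidAlgebra.single (-v) (1 : k) = c := by
        rw [← mul_one (AddMonoidAlgebra.single (-v) (1 : k)), ← hvc, ← mul_assoc,
          AddMonoidAlgebra.single_mul_single, neg_add_cancel, mul_one,
          ← AddMonoidAlgebra.one_def, one_mul]
      exact this ▸ hc
  have hall : ∀ w, AddMonoidAlgebra.single w (1 : k) ∈ C := by
    intro w
    obtain ⟨a, ha, b, hb, hb0, hab⟩ := hfrac (AddMonoidAlgebra.single w 1)
    obtain ⟨v, hv⟩ : b.coeff.support.Nonempty := by simpa using hb0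
    have hwv : w + v ∈ a.coeff.support := by
      rw [← hab]
      simpa using hv
    have h := C.mul_mem (hmono a ha _ hwv) (hinv v (hmono b hb v hv))
    rwa [AddMonoidAlgebra.single_mul_single, add_neg_cancel_right, mul_one] at h
  refine eq_top_iff.2 fun f _ ↦ ?_
  rw [← AddMonoidAlgebra.sum_coeff_single f]
  refine C.sum_mem fun v _ ↦ ?_
  simpa using C.smul_mem (hall v) (f.coeff v)
end

section
/- Let R be a commutative noetherian domain with ring automorphism σ, and let J be a nonzero ideal of R such that for every nonzero ideal I of R the set { i ∈ ℤ | I + σ^i(J) ≠ R } is finite (critical density of the orbit of the subscheme defined by J). Suppose V : ℕ → Ideal R is a sequence of ideals satisfying V_n · σ^n(J) ⊆ V_{n+1} ⊆ J·σ(J)⋯σ^n(J) for all n ≥ 0, and V_r ≠ 0 for some r. Then there exists n_0 such that V_{n+1} = V_n · σ^n(J) for all n ≥ n_0. -/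
/-- The saturation of `K` with respect to the multiplicative set `1 + I`. -/
def Ideal.oneAddSaturation {R : Type*} [CommRing R] (I K : Ideal R) : Ideal R where
  carrier := {x | ∃ b : R, 1 - b ∈ I ∧ b * x ∈ K}
  zero_mem' := ⟨1, by simp, by simp⟩
  add_mem' := by
    rintro x y ⟨b, hb, hbx⟩ ⟨c, hc, hcy⟩
    refine ⟨b * c, ?_, ?_⟩
    · convert I.add_mem hb (I.mul_mem_left b hc) using 1
      ring
    · convert K.add_mem (K.mul_mem_left c hbx) (K.mul_mem_left b hcy) using 1
      ring
  smul_mem' := by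
    rintro a x ⟨b, hb, hbx⟩
    refine ⟨b, hb, ?_⟩
    convert K.mul_mem_left a hbx using 1
    rw [smul_eq_mul]
    ring

theorem Ideal.mul_prod_Ico_le {R : Type*} [CommRing R] {V J : ℕ → Ideal R}
    (hV : ∀ n, V n * J n ≤ V (n + 1)) {r n : ℕ} (hrn : r ≤ n) :
    V r * ∏ j ∈ Finset.Ico r n, J j ≤ V n := by
  induction n, hrn using Nat.le_induction with
  | base => simp
  | succ n hn ih =>
    rw [Finset.prod_Ico_succ_top hn, ← mul_assoc]
    exact (Ideal.mul_mono_left ih).trans (hV n)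

/-- If `V n * J n ≤ V (n + 1) ≤ J 0 * ⋯ * J n` for all `n` and some `V r` is comaximal with
`J n` for all large `n`, then `V (n + 1) = V n * J n` for all large `n`. -/
theorem Ideal.eventually_eq_mul_of_comaximal {R : Type*} [CommRing R] [IsNoetherianRing R]
    {V J : ℕ → Ideal R} (hlow : ∀ n, V n * J n ≤ V (n + 1))
    (hupp : ∀ n, V (n + 1) ≤ ∏ j ∈ Finset.range (n + 1), J j)
    {r m : ℕ} (hcomax : ∀ n, m ≤ n → V r + J n = ⊤) :
    ∃ n₀ : ℕ, ∀ n, n₀ ≤ n → V (n + 1) = V n * J n := by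
  have hunit : ∀ n, m ≤ n → ∃ c ∈ J n, 1 - c ∈ V r := by
    intro n hn
    obtain ⟨i, hi, c, hc, hic⟩ :=
      Submodule.mem_sup.mp ((Ideal.eq_top_iff_one _).mp (hcomax n hn))
    exact ⟨c, hc, by rwa [← hic, add_sub_cancel_right]⟩
  have hmul : ∀ {b c : R}, 1 - b ∈ V r → 1 - c ∈ V r → 1 - c * b ∈ V r := by
    intro b c hb hc
    convert (V r).add_mem hc ((V r).mul_mem_left c hb) using 1
    ring
  have hmono : Monotone fun k => Ideal.oneAddSaturation (V r) (V (m + k)) := by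
    refine monotone_nat_of_le_succ fun k => ?_
    rintro x ⟨b, hb, hbx⟩
    obtain ⟨c, hc, hc1⟩ := hunit (m + k) (Nat.le_add_right m k)
    refine ⟨c * b, hmul hb hc1, hlow (m + k) ?_⟩
    rw [mul_assoc, mul_comm c]
    exact Ideal.mul_mem_mul hbx hc
  obtain ⟨N, hN⟩ := monotone_stabilizes_iff_noetherian.mpr ‹IsNoetherian R R› ⟨_, hmono⟩
  refine ⟨max r (m + N), fun n hn => le_antisymm (fun x hx => ?_) (hlow n)⟩
  obtain ⟨hrn, hmn⟩ := max_le_iff.mp hn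
  obtain ⟨k, rfl⟩ := Nat.exists_eq_add_of_le ((Nat.le_add_right m N).trans hmn)
  have hNk : N ≤ k := by omega
  have hsat : Ideal.oneAddSaturation (V r) (V (m + k)) =
      Ideal.oneAddSaturation (V r) (V (m + k + 1)) :=
    (hN k hNk).symm.trans (hN (k + 1) (by omega))
  have hx' : x ∈ Ideal.oneAddSaturation (V r) (V (m + k)) := by
    rw [hsat]
    exact ⟨1, by simp, by simpa using hx⟩
  obtain ⟨b, hb, hbx⟩ := hx'
  obtain ⟨c, hc, hc1⟩ := hunit (m + k) (Nat.le_add_right m k)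
  have hprod : V r * V (m + k + 1) ≤ V (m + k) * J (m + k) := by
    calc V r * V (m + k + 1) ≤ V r * ∏ j ∈ Finset.Ico r (m + k + 1), J j := by
          refine Ideal.mul_mono_right ((hupp (m + k)).trans ?_)
          rw [← Finset.prod_range_mul_prod_Ico _ (hrn.trans (Nat.le_succ _))]
          exact Ideal.mul_le_right
      _ ≤ V (m + k) * J (m + k) := by
          rw [Finset.prod_Ico_succ_top hrn, ← mul_assoc]
          exact Ideal.mul_mono_left (Ideal.mul_prod_Ico_le hlow hrn)
  convert Ideal.add_mem _ (hprod (Ideal.mul_mem_mul (hmul hb hc1) hx))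
    (Ideal.mul_mem_mul hbx hc) using 1
  ring


/-- Let `R` be a commutative noetherian domain with automorphism `σ` and `J` a nonzero
ideal whose orbit is critically dense: for every nonzero ideal `I`, the set of `i ∈ ℤ`
with `I + σ^i(J) ≠ R` is finite. If `V : ℕ → Ideal R` satisfies
`V_n·σ^n(J) ⊆ V_{n+1} ⊆ J·σ(J)⋯σ^n(J)` for all `n`, and `V_r ≠ 0` for some `r`, then
`V_{n+1} = V_n·σ^n(J)` for all `n ≫ 0`. -/
theorem ideal_sequence_stabilizes (R : Type*) [CommRing R] [IsDomain R]
    [IsNoetherianRing R] (σ : R ≃+* R) (J : Ideal R) (hJ : J ≠ ⊥)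
    (hcd : ∀ I : Ideal R, I ≠ ⊥ → {i : ℤ | I + Ideal.map (σ ^ i) J ≠ ⊤}.Finite)
    (V : ℕ → Ideal R)
    (hV : ∀ n : ℕ, V n * Ideal.map (σ ^ (n : ℤ)) J ≤ V (n + 1) ∧
      V (n + 1) ≤ ∏ j ∈ Finset.range (n + 1), Ideal.map (σ ^ (j : ℤ)) J)
    (hVr : ∃ r : ℕ, V r ≠ ⊥) :
    ∃ n₀ : ℕ, ∀ n : ℕ, n₀ ≤ n → V (n + 1) = V n * Ideal.map (σ ^ (n : ℤ)) J := by
  obtain ⟨r, hr⟩ := hVr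
  obtain ⟨m, hm⟩ := ((hcd (V r) hr).preimage (Nat.cast_injective (R := ℤ)).injOn).bddAbove
  refine Ideal.eventually_eq_mul_of_comaximal (r := r) (m := m + 1) (fun n => (hV n).1)
    (fun n => (hV n).2) fun n hn => ?_
  by_contra hne
  exact absurd (hm hne) (by omega)
end

section
/- Let S be a type with a bijection σ : S ≃ S. Let E : ℕ → (S →₀ ℤ) be a sequence of divisors such that: E_0 = 0; E_i + σ^{-i}(E_j) ≤ E_{i+j} pointwise for all i, j ≥ 0; there exists r ≥ 1 such that E_n = max_{1 ≤ i ≤ r} (E_i + σ^{-i}(E_{n-i})) pointwise for all n > r; and every point s ∈ S lying in the support of some E_i has infinite σ-orbit (σ^n(s) ≠ s for all n ≠ 0). Then there exist divisors G, Ω : S →₀ ℤ with Ω effective (pointwise ≥ 0) and an n_0 such that E_n = G_n - Ω for all n ≥ n_0, where G_n = Σ_{j=0}^{n-1} σ^{-j}(G). -/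
section SigmaSequence

variable {S : Type*} {σ : Equiv.Perm S} {e : ℕ → S → ℤ} {r : ℕ}

theorem eq_zero_of_forall_window_zero
    (hrec : ∀ n, r < n → ∀ s, ∃ i, 1 ≤ i ∧ i ≤ r ∧ e n s = e i s + e (n - i) ((σ ^ i) s))
    (n : ℕ) (s : S) (hs : ∀ k : ℕ, ∀ i ≤ r, e i ((σ ^ k) s) = 0) : e n s = 0 := by
  induction n using Nat.strong_induction_on generalizing s with
  | _ n ih =>
    rcases le_or_gt n r with hn | hn
    · simpa using hs 0 n hn
    · obtain ⟨i, hi1, hir, h⟩ := hrec n hn s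
      have h1 : e i s = 0 := by simpa using hs 0 i hir
      have h2 : e (n - i) ((σ ^ i) s) = 0 := by
        refine ih _ (by omega) _ fun k j hj => ?_
        rw [← Equiv.Perm.mul_apply, ← pow_add]
        exact hs _ j hj
      rw [h, h1, h2, add_zero]

theorem succ_eq_of_window_zero_after
    (hadd : ∀ i j s, e i s + e j ((σ ^ i) s) ≤ e (i + j) s)
    (hrec : ∀ n, r < n → ∀ s, ∃ i, 1 ≤ i ∧ i ≤ r ∧ e n s = e i s + e (n - i) ((σ ^ i) s))
    (n : ℕ) (s : S) (hs : ∀ k : ℕ, n ≤ k → ∀ i ≤ r, e i ((σ ^ k) s) = 0)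
    (m : ℕ) (hm : n + r ≤ m) : e (m + 1) s = e m s := by
  induction n using Nat.strong_induction_on generalizing s m with
  | _ n ih =>
    rcases Nat.eq_zero_or_pos n with rfl | hn
    · have hz : ∀ k : ℕ, ∀ i ≤ r, e i ((σ ^ k) s) = 0 := fun k => hs k k.zero_le
      rw [eq_zero_of_forall_window_zero hrec _ s hz, eq_zero_of_forall_window_zero hrec _ s hz]
    have tail : ∀ i, 1 ≤ i → i ≤ r →
        e (m + 1 - i) ((σ ^ i) s) = e (m - i) ((σ ^ i) s) := by
      intro i hi1 hir
      have hshift : ∀ k : ℕ, n - i ≤ k → ∀ j ≤ r, e j ((σ ^ k) ((σ ^ i) s)) = 0 := by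
        intro k hk j hj
        rw [← Equiv.Perm.mul_apply, ← pow_add]
        exact hs _ (by omega) j hj
      rcases le_or_gt i n with hin | hin
      · rw [show m + 1 - i = m - i + 1 by omega]
        exact ih (n - i) (by omega) _ hshift _ (by omega)
      · have hz : ∀ k : ℕ, ∀ j ≤ r, e j ((σ ^ k) ((σ ^ i) s)) = 0 :=
          fun k => hshift k (by omega)
        rw [eq_zero_of_forall_window_zero hrec _ _ hz,
          eq_zero_of_forall_window_zero hrec _ _ hz]
    apply le_antisymm
    · obtain ⟨i, hi1, hir, h⟩ := hrec (m + 1) (by omega) s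
      have := hadd i (m - i) s
      rw [show i + (m - i) = m by omega] at this
      rwa [h, tail i hi1 hir]
    · obtain ⟨i, hi1, hir, h⟩ := hrec m (by omega) s
      have := hadd i (m + 1 - i) s
      rw [show i + (m + 1 - i) = m + 1 by omega] at this
      rwa [h, ← tail i hi1 hir]

theorem succ_eq_apply_of_window_zero (hr : 1 ≤ r)
    (hadd : ∀ i j s, e i s + e j ((σ ^ i) s) ≤ e (i + j) s)
    (hrec : ∀ n, r < n → ∀ s, ∃ i, 1 ≤ i ∧ i ≤ r ∧ e n s = e i s + e (n - i) ((σ ^ i) s))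
    (s : S) (hs : ∀ i ≤ r, e i s = 0) (hs' : ∀ i ≤ r, e i (σ s) = 0)
    (n : ℕ) (hn : r ≤ n) : e (n + 1) s = e n (σ s) := by
  apply le_antisymm
  · obtain ⟨i, hi1, hir, h⟩ := hrec (n + 1) (by omega) s
    obtain ⟨i, rfl⟩ : ∃ j, i = j + 1 := ⟨i - 1, by omega⟩
    have := hadd i (n - i) (σ s)
    rw [hs' i (by omega), ← Equiv.Perm.mul_apply, ← pow_succ,
      show i + (n - i) = n by omega] at this
    rw [h, hs _ hir, show n + 1 - (i + 1) = n - i by omega]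
    exact this
  · have := hadd 1 n s
    rw [hs 1 hr, pow_one, zero_add, add_comm 1 n] at this
    exact this

theorem exists_window_zero_after_of_finite
    (hfin : {s | ∃ i ≤ r, e i s ≠ 0}.Finite)
    (horb : ∀ s, (∃ i, e i s ≠ 0) → ∀ n : ℤ, n ≠ 0 → (σ ^ n) s ≠ s) :
    ∃ M : ℕ, ∀ s, (∃ i ≤ r, e i s ≠ 0) → ∀ k : ℕ, M < k → ∀ i ≤ r, e i ((σ ^ k) s) = 0 := by
  have hbdd : (⋃ s ∈ {s | ∃ i ≤ r, e i s ≠ 0},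
      (fun k : ℕ => (σ ^ k) s) ⁻¹' {s | ∃ i ≤ r, e i s ≠ 0}).Finite := by
    refine hfin.biUnion fun s hs => hfin.preimage ?_
    obtain ⟨i, -, hi⟩ := hs
    intro a _ b _ hab
    by_contra hne
    refine horb s ⟨i, hi⟩ ((a : ℤ) - b) (by omega) ?_
    rw [sub_eq_neg_add, zpow_add, zpow_neg, zpow_natCast, zpow_natCast, Equiv.Perm.mul_apply,
      Equiv.Perm.inv_eq_iff_eq]
    exact hab
  obtain ⟨M, hM⟩ := hbdd.bddAbove
  refine ⟨M, fun s hs k hk i hi => ?_⟩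
  by_contra hne
  have : k ≤ M := hM (Set.mem_biUnion (x := s) hs ⟨i, hi, hne⟩)
  omega

theorem exists_forall_succ_sub_eq_apply (hr : 1 ≤ r)
    (hadd : ∀ i j s, e i s + e j ((σ ^ i) s) ≤ e (i + j) s)
    (hrec : ∀ n, r < n → ∀ s, ∃ i, 1 ≤ i ∧ i ≤ r ∧ e n s = e i s + e (n - i) ((σ ^ i) s))
    (hfin : {s | ∃ i ≤ r, e i s ≠ 0}.Finite)
    (horb : ∀ s, (∃ i, e i s ≠ 0) → ∀ n : ℤ, n ≠ 0 → (σ ^ n) s ≠ s) :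
    ∃ N : ℕ, ∀ d s, e (N + d + 1) s - e (N + d) s =
      e (N + 1) ((σ ^ d) s) - e N ((σ ^ d) s) := by
  obtain ⟨M, hM⟩ := exists_window_zero_after_of_finite hfin horb
  have step : ∀ n, M + r + 2 ≤ n → ∀ s,
      e (n + 2) s - e (n + 1) s = e (n + 1) (σ s) - e n (σ s) := by
    intro n hn s
    by_cases hs : (∃ i ≤ r, e i s ≠ 0) ∨ ∃ i ≤ r, e i (σ s) ≠ 0
    · have hlate : ∀ k : ℕ, M + 2 ≤ k → ∀ i ≤ r, e i ((σ ^ k) s) = 0 := by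
        intro k hk
        rcases hs with hs | hs
        · exact hM s hs k (by omega)
        · obtain ⟨k, rfl⟩ : ∃ j, k = j + 1 := ⟨k - 1, by omega⟩
          rw [pow_succ, Equiv.Perm.mul_apply]
          exact hM _ hs k (by omega)
      have hlate' : ∀ k : ℕ, M + 2 ≤ k → ∀ i ≤ r, e i ((σ ^ k) (σ s)) = 0 := by
        intro k hk
        rw [← Equiv.Perm.mul_apply, ← pow_succ]
        exact hlate _ (by omega)
      rw [succ_eq_of_window_zero_after hadd hrec _ s hlate (n + 1) (by omega),
        succ_eq_of_window_zero_after hadd hrec _ (σ s) hlate' n (by omega), sub_self, sub_self]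
    · push Not at hs
      rw [succ_eq_apply_of_window_zero hr hadd hrec s hs.1 hs.2 (n + 1) (by omega),
        succ_eq_apply_of_window_zero hr hadd hrec s hs.1 hs.2 n (by omega)]
  refine ⟨M + r + 2, fun d => ?_⟩
  induction d with
  | zero => simp
  | succ d ih =>
    intro s
    rw [pow_succ, Equiv.Perm.mul_apply, ← ih, ← step _ (by omega)]
    rfl

end SigmaSequence

theorem equivMapDomain_zpow_neg_apply {S : Type*} (σ : Equiv.Perm S) (i : ℕ) (D : S →₀ ℤ)
    (s : S) : Finsupp.equivMapDomain (σ ^ (-(i : ℤ))) D s = D ((σ ^ i) s) := by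
  rw [Finsupp.equivMapDomain_apply, zpow_neg, zpow_natCast]
  rfl

/-- A σ-divisor sequence `E` of divisors on `S` (pushforward action:
`(σ(D))(s) = D(σ^{-1}(s))`, so `σ^{-i}(D) = Finsupp.equivMapDomain (σ^(-i)) D`) with all
support points on infinite orbits is eventually of the form `E_n = G_n - Ω` for some
divisor `G` and effective divisor `Ω`, where `G_n = Σ_{j=0}^{n-1} σ^{-j}(G)`. -/
theorem sigma_divisor_sequence_form (S : Type*) (σ : Equiv.Perm S) (E : ℕ → (S →₀ ℤ))
    (hE0 : E 0 = 0)
    (hsub : ∀ i j : ℕ, ∀ s : S,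
      E i s + Finsupp.equivMapDomain (σ ^ (-(i : ℤ))) (E j) s ≤ E (i + j) s)
    (hmax : ∃ r : ℕ, ∃ hr : 1 ≤ r, ∀ n : ℕ, r < n → ∀ s : S,
      E n s = (Finset.Icc 1 r).sup' (Finset.nonempty_Icc.mpr hr)
        (fun i => E i s + Finsupp.equivMapDomain (σ ^ (-(i : ℤ))) (E (n - i)) s))
    (horb : ∀ s : S, (∃ i : ℕ, E i s ≠ 0) → ∀ n : ℤ, n ≠ 0 → (σ ^ n) s ≠ s) :
    ∃ (G Ω : S →₀ ℤ), (∀ s : S, 0 ≤ Ω s) ∧ ∃ n₀ : ℕ, ∀ n : ℕ, n₀ ≤ n →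
      E n = (∑ j ∈ Finset.range n, Finsupp.equivMapDomain (σ ^ (-(j : ℤ))) G) - Ω := by
  obtain ⟨r, hr, hmax⟩ := hmax
  simp only [equivMapDomain_zpow_neg_apply] at hsub hmax
  have hrec : ∀ n, r < n → ∀ s, ∃ i, 1 ≤ i ∧ i ≤ r ∧
      E n s = E i s + E (n - i) ((σ ^ i) s) := by
    intro n hn s
    obtain ⟨i, hi, h⟩ := Finset.exists_mem_eq_sup' (Finset.nonempty_Icc.mpr hr)
      (fun i => E i s + E (n - i) ((σ ^ i) s))
    rw [Finset.mem_Icc] at hi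
    exact ⟨i, hi.1, hi.2, (hmax n hn s).trans h⟩
  have hfin : {s | ∃ i ≤ r, E i s ≠ 0}.Finite := by
    refine ((Set.finite_Iic r).biUnion fun i _ => (E i).hasFiniteSupport).subset ?_
    rintro s ⟨i, hi, hne⟩
    exact Set.mem_biUnion (x := i) hi hne
  obtain ⟨N, hN⟩ := exists_forall_succ_sub_eq_apply (e := fun n s => E n s) hr hsub hrec hfin horb
  set G : S →₀ ℤ := Finsupp.equivMapDomain (σ ^ N) (E (N + 1) - E N) with hG
  set Ω : S →₀ ℤ :=
    (∑ j ∈ Finset.range N, Finsupp.equivMapDomain (σ ^ (-(j : ℤ))) G) - E N with hΩ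
  have hΩ_apply : ∀ s, Ω s = ∑ j ∈ Finset.range N, G ((σ ^ j) s) - E N s := by
    intro s
    simp only [hΩ, Finsupp.sub_apply, Finsupp.finsetSum_apply, equivMapDomain_zpow_neg_apply]
  have hG_apply : ∀ d s, G ((σ ^ (N + d)) s) = E (N + d + 1) s - E (N + d) s := by
    intro d s
    rw [hN, hG, Finsupp.equivMapDomain_apply, pow_add, Equiv.Perm.mul_apply,
      Equiv.symm_apply_apply, Finsupp.sub_apply]
  have form : ∀ n, N ≤ n → ∀ s, E n s = ∑ j ∈ Finset.range n, G ((σ ^ j) s) - Ω s := by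
    intro n hn s
    obtain ⟨d, rfl⟩ := Nat.exists_eq_add_of_le hn
    induction d with
    | zero => simp [hΩ_apply]
    | succ d ih =>
      rw [← add_assoc, Finset.sum_range_succ, hG_apply]
      linarith [ih (by omega)]
  refine ⟨G, Ω, fun s => ?_, N, fun n hn => ?_⟩
  · obtain ⟨t, rfl⟩ := (σ ^ N).surjective s
    have h := hsub N N t
    rw [form N le_rfl t, form N le_rfl, form (N + N) (by omega) t, Finset.sum_range_add] at h
    simp only [← Equiv.Perm.mul_apply, ← pow_add, add_comm _ N] at h ⊢
    linarith
  · ext s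
    rw [form n hn s]
    simp only [Finsupp.sub_apply, Finsupp.finsetSum_apply, equivMapDomain_zpow_neg_apply]
end
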